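/- With A, N, H = AN ⊂ GL(n+1,ℝ) as in the preceding statement acting on ℝ^{n+1} by h·v = (h⁻¹)ᵀ v, and β(v,w) = v₁w₁ − Σ_{j=2}^{n+1} v_j w_j, the four sets 𝒪₁ = {β(v,v)>0, v₁>0}, 𝒪₂ = {β(v,v)>0, v₁<0}, 𝒪₃ = {β(v,v)<0, v₁<v_{n+1}}, 𝒪₄ = {β(v,v)<0, v₁>v_{n+1}} are exactly the H-orbits of e₁, −e₁, e_{n+1}, −e_{n+1} respectively; they are open, pairwise disjoint, and the complement of their union, namely {v : β(v,v)=0} ∪ {v : β(v,v)<0, v₁=v_{n+1}}, has Lebesgue measure zero in ℝ^{n+1}. -/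

import Mathlib

open Matrix Set MeasureTheory

/-- Index type for `(n+1)×(n+1)` matrices in `1 + (n-1) + 1` block form (`m = n - 1`). -/
abbrev Idx (m : ℕ) := Unit ⊕ Fin m ⊕ Unit

/-- The matrix `a(λ,t)`. -/
noncomputable def aMat (m : ℕ) (lam t : ℝ) : Matrix (Idx m) (Idx m) ℝ :=
  Matrix.of fun i j =>
    lam * (match i, j with
      | Sum.inl _, Sum.inl _ => Real.cosh t
      | Sum.inl _, Sum.inr (Sum.inr _) => Real.sinh t
      | Sum.inr (Sum.inr _), Sum.inl _ => Real.sinh t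
      | Sum.inr (Sum.inr _), Sum.inr (Sum.inr _) => Real.cosh t
      | Sum.inr (Sum.inl k), Sum.inr (Sum.inl l) => if k = l then 1 else 0
      | _, _ => 0)

/-- The unipotent matrix `n(x)`. -/
noncomputable def nMat (m : ℕ) (x : Fin m → ℝ) : Matrix (Idx m) (Idx m) ℝ :=
  Matrix.of fun i j =>
    match i, j with
    | Sum.inl _, Sum.inl _ => 1 + (∑ k, x k ^ 2) / 2
    | Sum.inl _, Sum.inr (Sum.inl l) => x l
    | Sum.inl _, Sum.inr (Sum.inr _) => (∑ k, x k ^ 2) / 2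
    | Sum.inr (Sum.inl k), Sum.inl _ => x k
    | Sum.inr (Sum.inl k), Sum.inr (Sum.inl l) => if k = l then 1 else 0
    | Sum.inr (Sum.inl k), Sum.inr (Sum.inr _) => x k
    | Sum.inr (Sum.inr _), Sum.inl _ => -((∑ k, x k ^ 2) / 2)
    | Sum.inr (Sum.inr _), Sum.inr (Sum.inl l) => -(x l)
    | Sum.inr (Sum.inr _), Sum.inr (Sum.inr _) => 1 - (∑ k, x k ^ 2) / 2

/-- The bilinear form `β(v,w) = v₁w₁ − Σ_{j≥2} v_j w_j` on `ℝ^{n+1}`. -/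
def betaForm (m : ℕ) (v w : Idx m → ℝ) : ℝ :=
  v (Sum.inl ()) * w (Sum.inl ()) - (∑ k : Fin m, v (Sum.inr (Sum.inl k)) * w (Sum.inr (Sum.inl k)))
    - v (Sum.inr (Sum.inr ())) * w (Sum.inr (Sum.inr ()))

/-- The twisted action `h · v = (h⁻¹)ᵀ v`. -/
noncomputable def act (m : ℕ) (h : Matrix (Idx m) (Idx m) ℝ) (v : Idx m → ℝ) : Idx m → ℝ :=
  (h⁻¹)ᵀ *ᵥ v

/-- The group `H = AN`. -/
def Hset (m : ℕ) : Set (Matrix (Idx m) (Idx m) ℝ) :=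
  {g | ∃ (lam t : ℝ) (x : Fin m → ℝ), 0 < lam ∧ g = aMat m lam t * nMat m x}

/-- The `H`-orbit of `w` under the twisted action. -/
def orbitOf (m : ℕ) (w : Idx m → ℝ) : Set (Idx m → ℝ) :=
  {v | ∃ g ∈ Hset m, v = act m g w}

theorem aMat_mul_aMat_neg (m : ℕ) {lam : ℝ} (h : lam ≠ 0) (t : ℝ) :
    aMat m lam t * aMat m lam⁻¹ (-t) = 1 := by
  have hc := Real.cosh_sq t
  ext i j
  rcases i with _ | i | _ <;> rcases j with _ | j | _ <;>
    simp [aMat, Matrix.mul_apply, Fintype.sum_sum_type, Matrix.one_apply, h] <;>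
    field_simp <;> linarith

theorem nMat_mul_nMat_neg (m : ℕ) (x : Fin m → ℝ) : nMat m x * nMat m (-x) = 1 := by
  ext i j
  rcases i with _ | i | _ <;> rcases j with _ | j | _ <;>
    simp [nMat, Matrix.mul_apply, Fintype.sum_sum_type, Matrix.one_apply, ← pow_two] <;> ring

theorem inv_aMat_mul_nMat (m : ℕ) {lam : ℝ} (h : lam ≠ 0) (t : ℝ) (x : Fin m → ℝ) :
    (aMat m lam t * nMat m x)⁻¹ = nMat m (-x) * aMat m lam⁻¹ (-t) := by
  rw [Matrix.mul_inv_rev, Matrix.inv_eq_right_inv (aMat_mul_aMat_neg m h t),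
    Matrix.inv_eq_right_inv (nMat_mul_nMat_neg m x)]

/-- The linear form `v₁ - v_{n+1}`, an eigenvector of the twisted action of `H`. -/
def nullCoord {m : ℕ} (v : Idx m → ℝ) : ℝ :=
  v (Sum.inl ()) - v (Sum.inr (Sum.inr ()))

theorem act_aMat_mul_nMat (m : ℕ) {lam : ℝ} (h : lam ≠ 0) (t : ℝ) (x : Fin m → ℝ)
    (v : Idx m → ℝ) :
    act m (aMat m lam t * nMat m x) v = (aMat m lam⁻¹ (-t))ᵀ *ᵥ ((nMat m (-x))ᵀ *ᵥ v) := by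
  rw [act, inv_aMat_mul_nMat m h, Matrix.transpose_mul, Matrix.mulVec_mulVec]

theorem nMat_mulVec_inl (m : ℕ) (x : Fin m → ℝ) (v : Idx m → ℝ) :
    ((nMat m (-x))ᵀ *ᵥ v) (Sum.inl ()) = v (Sum.inl ())
      + nullCoord v * ((∑ k, x k ^ 2) / 2) - ∑ k, x k * v (Sum.inr (Sum.inl k)) := by
  simp [nMat, nullCoord, Matrix.mulVec, dotProduct, Fintype.sum_sum_type]
  ring

theorem nMat_mulVec_mid (m : ℕ) (x : Fin m → ℝ) (v : Idx m → ℝ) (k : Fin m) :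
    ((nMat m (-x))ᵀ *ᵥ v) (Sum.inr (Sum.inl k)) =
      v (Sum.inr (Sum.inl k)) - nullCoord v * x k := by
  simp [nMat, nullCoord, Matrix.mulVec, dotProduct, Fintype.sum_sum_type]
  ring

theorem nMat_mulVec_inr (m : ℕ) (x : Fin m → ℝ) (v : Idx m → ℝ) :
    ((nMat m (-x))ᵀ *ᵥ v) (Sum.inr (Sum.inr ())) = v (Sum.inr (Sum.inr ()))
      + nullCoord v * ((∑ k, x k ^ 2) / 2) - ∑ k, x k * v (Sum.inr (Sum.inl k)) := by
  simp [nMat, nullCoord, Matrix.mulVec, dotProduct, Fintype.sum_sum_type]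
  ring

theorem nullCoord_nMat_mulVec (m : ℕ) (x : Fin m → ℝ) (v : Idx m → ℝ) :
    nullCoord ((nMat m (-x))ᵀ *ᵥ v) = nullCoord v := by
  rw [nullCoord, nMat_mulVec_inl, nMat_mulVec_inr, nullCoord]
  ring

theorem betaForm_nMat_mulVec (m : ℕ) (x : Fin m → ℝ) (v : Idx m → ℝ) :
    betaForm m ((nMat m (-x))ᵀ *ᵥ v) ((nMat m (-x))ᵀ *ᵥ v) = betaForm m v v := by
  have hsum : ∑ k, (v (Sum.inr (Sum.inl k)) - nullCoord v * x k) *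
        (v (Sum.inr (Sum.inl k)) - nullCoord v * x k) =
      (∑ k, v (Sum.inr (Sum.inl k)) * v (Sum.inr (Sum.inl k)))
        - 2 * nullCoord v * (∑ k, x k * v (Sum.inr (Sum.inl k)))
        + nullCoord v ^ 2 * ∑ k, x k ^ 2 := by
    simp only [Finset.mul_sum, ← Finset.sum_sub_distrib, ← Finset.sum_add_distrib]
    exact Finset.sum_congr rfl fun k _ => by ring
  simp only [betaForm, nMat_mulVec_inl, nMat_mulVec_mid, nMat_mulVec_inr, hsum]
  simp only [nullCoord]
  ring

theorem aMat_mulVec_inl (m : ℕ) (lam t : ℝ) (v : Idx m → ℝ) :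
    ((aMat m lam (-t))ᵀ *ᵥ v) (Sum.inl ()) =
      lam * (Real.cosh t * v (Sum.inl ()) - Real.sinh t * v (Sum.inr (Sum.inr ()))) := by
  simp [aMat, Matrix.mulVec, dotProduct, Fintype.sum_sum_type]
  ring

theorem aMat_mulVec_mid (m : ℕ) (lam t : ℝ) (v : Idx m → ℝ) (k : Fin m) :
    ((aMat m lam (-t))ᵀ *ᵥ v) (Sum.inr (Sum.inl k)) = lam * v (Sum.inr (Sum.inl k)) := by
  simp [aMat, Matrix.mulVec, dotProduct, Fintype.sum_sum_type]

theorem aMat_mulVec_inr (m : ℕ) (lam t : ℝ) (v : Idx m → ℝ) :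
    ((aMat m lam (-t))ᵀ *ᵥ v) (Sum.inr (Sum.inr ())) =
      lam * (Real.cosh t * v (Sum.inr (Sum.inr ())) - Real.sinh t * v (Sum.inl ())) := by
  simp [aMat, Matrix.mulVec, dotProduct, Fintype.sum_sum_type]
  ring

theorem nullCoord_aMat_mulVec (m : ℕ) (lam t : ℝ) (v : Idx m → ℝ) :
    nullCoord ((aMat m lam (-t))ᵀ *ᵥ v) = lam * Real.exp t * nullCoord v := by
  rw [nullCoord, aMat_mulVec_inl, aMat_mulVec_inr, nullCoord, ← Real.cosh_add_sinh]
  ring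

theorem betaForm_aMat_mulVec (m : ℕ) (lam t : ℝ) (v : Idx m → ℝ) :
    betaForm m ((aMat m lam (-t))ᵀ *ᵥ v) ((aMat m lam (-t))ᵀ *ᵥ v) =
      lam ^ 2 * betaForm m v v := by
  have hsum : ∑ k, lam * v (Sum.inr (Sum.inl k)) * (lam * v (Sum.inr (Sum.inl k))) =
      lam ^ 2 * ∑ k, v (Sum.inr (Sum.inl k)) * v (Sum.inr (Sum.inl k)) := by
    rw [Finset.mul_sum]
    exact Finset.sum_congr rfl fun k _ => by ring
  simp only [betaForm, aMat_mulVec_inl, aMat_mulVec_mid, aMat_mulVec_inr, hsum]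
  linear_combination lam ^ 2 * (v (Sum.inl ()) ^ 2 - v (Sum.inr (Sum.inr ())) ^ 2) *
    Real.cosh_sq t

theorem nullCoord_act (m : ℕ) {lam : ℝ} (h : lam ≠ 0) (t : ℝ) (x : Fin m → ℝ)
    (v : Idx m → ℝ) :
    nullCoord (act m (aMat m lam t * nMat m x) v) = lam⁻¹ * Real.exp t * nullCoord v := by
  rw [act_aMat_mul_nMat m h, nullCoord_aMat_mulVec, nullCoord_nMat_mulVec]

theorem betaForm_act (m : ℕ) {lam : ℝ} (h : lam ≠ 0) (t : ℝ) (x : Fin m → ℝ)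
    (v : Idx m → ℝ) :
    betaForm m (act m (aMat m lam t * nMat m x) v) (act m (aMat m lam t * nMat m x) v) =
      lam⁻¹ ^ 2 * betaForm m v v := by
  rw [act_aMat_mul_nMat m h, betaForm_aMat_mulVec, betaForm_nMat_mulVec]

theorem act_mid (m : ℕ) {lam : ℝ} (h : lam ≠ 0) (t : ℝ) (x : Fin m → ℝ)
    (v : Idx m → ℝ) (k : Fin m) :
    act m (aMat m lam t * nMat m x) v (Sum.inr (Sum.inl k)) =
      lam⁻¹ * (v (Sum.inr (Sum.inl k)) - nullCoord v * x k) := by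
  rw [act_aMat_mul_nMat m h, aMat_mulVec_mid, nMat_mulVec_mid]

theorem eq_of_nullCoord_of_betaForm {m : ℕ} {v w : Idx m → ℝ} (h0 : nullCoord w ≠ 0)
    (hnull : nullCoord v = nullCoord w) (hbeta : betaForm m v v = betaForm m w w)
    (hmid : ∀ k, v (Sum.inr (Sum.inl k)) = w (Sum.inr (Sum.inl k))) : v = w := by
  simp only [betaForm, hmid] at hbeta
  simp only [nullCoord] at h0 hnull
  have hsum : v (Sum.inl ()) + v (Sum.inr (Sum.inr ())) =
      w (Sum.inl ()) + w (Sum.inr (Sum.inr ())) := by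
    apply mul_left_cancel₀ h0
    linear_combination hbeta - (v (Sum.inl ()) + v (Sum.inr (Sum.inr ()))) * hnull
  ext i
  rcases i with _ | k | _
  · change v (Sum.inl ()) = w (Sum.inl ())
    linarith
  · exact hmid k
  · change v (Sum.inr (Sum.inr ())) = w (Sum.inr (Sum.inr ()))
    linarith

theorem orbitOf_eq {m : ℕ} {w : Idx m → ℝ} (hnull : nullCoord w ≠ 0)
    (hbeta : betaForm m w w ≠ 0) :
    orbitOf m w =
      {v | 0 < betaForm m v v / betaForm m w w ∧ 0 < nullCoord v / nullCoord w} := by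
  ext v
  constructor
  · rintro ⟨_, ⟨lam, t, x, hlam, rfl⟩, rfl⟩
    rw [mem_ofPred_eq, betaForm_act m hlam.ne', nullCoord_act m hlam.ne',
      mul_div_cancel_right₀ _ hbeta, mul_div_cancel_right₀ _ hnull]
    constructor <;> positivity
  · rintro ⟨hb, hn⟩
    set r := √(betaForm m v v / betaForm m w w) with hr
    have hr0 : 0 < r := Real.sqrt_pos.2 hb
    have hrr : r ^ 2 = betaForm m v v / betaForm m w w := Real.sq_sqrt hb.le
    have hv : nullCoord v ≠ 0 := by
      rintro h
      simp [h] at hn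
    refine ⟨_, ⟨r⁻¹, Real.log (r⁻¹ * (nullCoord v / nullCoord w)), fun k =>
      (w (Sum.inr (Sum.inl k)) - r⁻¹ * v (Sum.inr (Sum.inl k))) / nullCoord w,
      by positivity, rfl⟩, ?_⟩
    have hri : r⁻¹ ≠ 0 := by positivity
    symm
    apply eq_of_nullCoord_of_betaForm hv
    · rw [nullCoord_act m hri, Real.exp_log (by positivity)]
      field_simp
    · rw [betaForm_act m hri, inv_inv, hrr]
      field_simp
    · intro k
      rw [act_mid m hri]
      field_simp
      ring

theorem continuous_betaForm (m : ℕ) : Continuous fun v : Idx m → ℝ => betaForm m v v := by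
  unfold betaForm
  fun_prop

theorem continuous_nullCoord (m : ℕ) : Continuous (nullCoord : (Idx m → ℝ) → ℝ) := by
  unfold nullCoord
  fun_prop

theorem betaForm_le_nullCoord_mul (m : ℕ) (v : Idx m → ℝ) :
    betaForm m v v ≤ nullCoord v * (v (Sum.inl ()) + v (Sum.inr (Sum.inr ()))) := by
  have := Finset.sum_nonneg fun (k : Fin m) (_ : k ∈ Finset.univ) =>
    mul_self_nonneg (v (Sum.inr (Sum.inl k)))
  simp only [betaForm, nullCoord]
  linarith

/-- On the cone `0 < β(v,v)`, the forms `v₁` and `v₁ - v_{n+1}` have the same sign. -/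
theorem inl_pos_iff_nullCoord_pos {m : ℕ} {v : Idx m → ℝ} (h : 0 < betaForm m v v) :
    0 < v (Sum.inl ()) ↔ 0 < nullCoord v := by
  have h1 := h.trans_le (betaForm_le_nullCoord_mul m v)
  rcases mul_pos_iff.1 h1 with ⟨h2, h3⟩ | ⟨h2, h3⟩ <;> simp only [nullCoord] at * <;>
    constructor <;> intro <;> linarith

theorem inl_neg_iff_nullCoord_neg {m : ℕ} {v : Idx m → ℝ} (h : 0 < betaForm m v v) :
    v (Sum.inl ()) < 0 ↔ nullCoord v < 0 := by
  have h1 := h.trans_le (betaForm_le_nullCoord_mul m v)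
  rcases mul_pos_iff.1 h1 with ⟨h2, h3⟩ | ⟨h2, h3⟩ <;> simp only [nullCoord] at * <;>
    constructor <;> intro <;> linarith

theorem volume_setOf_nullCoord_eq_zero (m : ℕ) :
    volume {v : Idx m → ℝ | nullCoord v = 0} = 0 := by
  let L : (Idx m → ℝ) →ₗ[ℝ] ℝ :=
    LinearMap.proj (R := ℝ) (φ := fun _ : Idx m => ℝ) (Sum.inl ()) -
      LinearMap.proj (R := ℝ) (φ := fun _ : Idx m => ℝ) (Sum.inr (Sum.inr ()))
  refine Measure.addHaar_submodule volume (LinearMap.ker L) fun htop => ?_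
  have h : (Pi.single (Sum.inl ()) 1 : Idx m → ℝ) ∈ LinearMap.ker L := htop ▸ Submodule.mem_top
  simp [L] at h

/-- Translating by a null vector `w` with `β(v,w) = v₁ - v_{n+1}` separates the points of the
null cone off the hyperplane `v₁ = v_{n+1}`. -/
theorem volume_setOf_betaForm_eq_zero (m : ℕ) :
    volume {v : Idx m → ℝ | betaForm m v v = 0} = 0 := by
  have hoff : volume {v : Idx m → ℝ | betaForm m v v = 0 ∧ nullCoord v ≠ 0} = 0 := by
    let w : Idx m → ℝ := Pi.single (Sum.inl ()) 1 + Pi.single (Sum.inr (Sum.inr ())) 1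
    have hw : ∀ (c : ℝ) (v : Idx m → ℝ), nullCoord (c • w + v) = nullCoord v ∧
        betaForm m (c • w + v) (c • w + v) = betaForm m v v + 2 * c * nullCoord v := by
      intro c v
      constructor
      · simp [w, nullCoord]
      · simp [w, betaForm, nullCoord]
        ring
    let u : ℕ → Idx m → ℝ := fun n => (1 / ((n : ℝ) + 1)) • w
    have hu : Bornology.IsBounded (range u) := by
      have := (tendsto_one_div_add_atTop_nhds_zero_nat (𝕜 := ℝ)).smul_const w
      exact Metric.isBounded_range_of_tendsto _ this
    refine Measure.addHaar_eq_zero_of_disjoint_translates volume u hu ?_ ?_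
    · intro i j hij
      refine Set.disjoint_left.2 fun y hi hj => hij ?_
      simp only [singleton_add, image_add_left, mem_preimage] at hi hj
      obtain ⟨hi1, hi2⟩ := hi
      obtain ⟨hj1, -⟩ := hj
      simp only [u, ← neg_smul] at hi1 hi2 hj1
      rw [(hw _ _).2] at hi1 hj1
      rw [(hw _ _).1] at hi2
      have : (1 / ((i : ℝ) + 1)) = 1 / ((j : ℝ) + 1) := by
        apply mul_right_cancel₀ hi2
        linarith
      simpa using this
    · exact (measurableSet_eq_fun (continuous_betaForm m).measurable measurable_const).inter
        (measurableSet_eq_fun (continuous_nullCoord m).measurable measurable_const).compl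
  refine measure_mono_null (fun v hv => ?_)
    (measure_union_null hoff (volume_setOf_nullCoord_eq_zero m))
  by_cases h : nullCoord v = 0
  · exact Or.inr h
  · exact Or.inl ⟨hv, h⟩

/-- The four sets `𝒪₁,…,𝒪₄` are exactly the `H`-orbits of
`e₁, −e₁, e_{n+1}, −e_{n+1}`; they are open and pairwise disjoint, and the complement of
their union is `{β(v,v)=0} ∪ {β(v,v)<0, v₁=v_{n+1}}`, a Lebesgue-null set. -/
theorem stmt11 (m : ℕ) :
    let e1 : Idx m → ℝ := Pi.single (Sum.inl ()) 1
    let eN : Idx m → ℝ := Pi.single (Sum.inr (Sum.inr ())) 1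
    let O1 : Set (Idx m → ℝ) := {v | 0 < betaForm m v v ∧ 0 < v (Sum.inl ())}
    let O2 : Set (Idx m → ℝ) := {v | 0 < betaForm m v v ∧ v (Sum.inl ()) < 0}
    let O3 : Set (Idx m → ℝ) :=
      {v | betaForm m v v < 0 ∧ v (Sum.inl ()) < v (Sum.inr (Sum.inr ()))}
    let O4 : Set (Idx m → ℝ) :=
      {v | betaForm m v v < 0 ∧ v (Sum.inr (Sum.inr ())) < v (Sum.inl ())}
    orbitOf m e1 = O1 ∧ orbitOf m (-e1) = O2 ∧
      orbitOf m eN = O3 ∧ orbitOf m (-eN) = O4 ∧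
      IsOpen O1 ∧ IsOpen O2 ∧ IsOpen O3 ∧ IsOpen O4 ∧
      Disjoint O1 O2 ∧ Disjoint O1 O3 ∧ Disjoint O1 O4 ∧
      Disjoint O2 O3 ∧ Disjoint O2 O4 ∧ Disjoint O3 O4 ∧
      (O1 ∪ O2 ∪ O3 ∪ O4)ᶜ =
        {v | betaForm m v v = 0} ∪
          {v | betaForm m v v < 0 ∧ v (Sum.inl ()) = v (Sum.inr (Sum.inr ()))} ∧
      volume ((O1 ∪ O2 ∪ O3 ∪ O4)ᶜ) = 0 := by
  intro e1 eN O1 O2 O3 O4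
  have hb1 : betaForm m e1 e1 = 1 := by simp [betaForm, e1]
  have hb2 : betaForm m (-e1) (-e1) = 1 := by simp [betaForm, e1]
  have hb3 : betaForm m eN eN = -1 := by simp [betaForm, eN]
  have hb4 : betaForm m (-eN) (-eN) = -1 := by simp [betaForm, eN]
  have hn1 : nullCoord e1 = 1 := by simp [nullCoord, e1]
  have hn2 : nullCoord (-e1) = -1 := by simp [nullCoord, e1]
  have hn3 : nullCoord eN = -1 := by simp [nullCoord, eN]
  have hn4 : nullCoord (-eN) = 1 := by simp [nullCoord, eN]
  have hB := continuous_betaForm m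
  have hcompl : (O1 ∪ O2 ∪ O3 ∪ O4)ᶜ = {v | betaForm m v v = 0} ∪
      {v | betaForm m v v < 0 ∧ v (Sum.inl ()) = v (Sum.inr (Sum.inr ()))} := by
    ext v
    have hpos : 0 < betaForm m v v → v (Sum.inl ()) ≠ 0 := by
      intro h h0
      have h1 := (inl_pos_iff_nullCoord_pos h).not
      have h2 := (inl_neg_iff_nullCoord_neg h).not
      have h3 := betaForm_le_nullCoord_mul m v
      simp only [h0, lt_irrefl, not_false_eq_true, true_iff, not_lt] at h1 h2
      rw [le_antisymm h1 h2, zero_mul] at h3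
      linarith
    simp only [O1, O2, O3, O4, mem_compl_iff, mem_union, mem_ofPred_eq]
    grind
  refine ⟨?_, ?_, ?_, ?_, ?_, ?_, ?_, ?_, ?_, ?_, ?_, ?_, ?_, ?_, hcompl, ?_⟩
  · rw [orbitOf_eq (by simp [hn1]) (by simp [hb1]), hb1, hn1]
    ext v
    simpa [O1] using fun h => (inl_pos_iff_nullCoord_pos h).symm
  · rw [orbitOf_eq (by simp [hn2]) (by simp [hb2]), hb2, hn2]
    ext v
    simpa [O2, div_neg] using fun h => (inl_neg_iff_nullCoord_neg h).symm
  · rw [orbitOf_eq (by simp [hn3]) (by simp [hb3]), hb3, hn3]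
    ext v
    simp [O3, nullCoord, div_neg]
  · rw [orbitOf_eq (by simp [hn4]) (by simp [hb4]), hb4, hn4]
    ext v
    simp [O4, nullCoord, div_neg]
  · exact (isOpen_lt continuous_const hB).inter
      (isOpen_lt continuous_const (continuous_apply _))
  · exact (isOpen_lt continuous_const hB).inter
      (isOpen_lt (continuous_apply _) continuous_const)
  · exact (isOpen_lt hB continuous_const).inter
      (isOpen_lt (continuous_apply _) (continuous_apply _))
  · exact (isOpen_lt hB continuous_const).inter
      (isOpen_lt (continuous_apply _) (continuous_apply _))
  iterate 6
    exact Set.disjoint_left.2 fun v h h' => by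
      obtain ⟨h1, h2⟩ := h
      obtain ⟨h3, h4⟩ := h'
      linarith
  rw [hcompl]
  refine measure_union_null (volume_setOf_betaForm_eq_zero m)
    (measure_mono_null (fun v hv => ?_) (volume_setOf_nullCoord_eq_zero m))
  exact sub_eq_zero.2 hv.2
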